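/- Let n ∈ ℤ, m = |n|, and let k ∈ ℂ with k ≠ 0. Suppose f : ℝ → ℂ is real-analytic on an open set containing the interval [0,1], satisfies r²(1−r²)f″(r) + r(1−r²)f′(r) + (4k r² − n²(1−r²))f(r) = 0 for all r ∈ (0,1), satisfies f(1) = 0, and is not identically zero on [0,1]. Then there exists a positive integer ν with k = ν(m+ν); in particular k is a positive integer. -/

import Mathlib

open Filter Topology

lemma seq_lemma (m : ℕ) (k : ℂ) (hk : k ≠ 0) (d : ℕ → ℂ) (h0 : d 0 ≠ 0)
    (hrec : ∀ N : ℕ, ((N:ℂ)+1)*((N:ℂ)+1+m) * d (N+1) = ((N:ℂ)*((N:ℂ)+m) - k) * d N)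
    (hno : ∀ ν : ℕ, 1 ≤ ν → k ≠ (ν:ℂ) * ((m:ℂ) + ν)) :
    Summable (fun j => ‖d j‖) ∧ ∑' j, d j ≠ 0 := by
  set q : ℕ → ℂ := fun N => ((N:ℂ)+1)*((N:ℂ)+1+m) with hq
  have hqn : ∀ N : ℕ, ((N:ℝ)+1)^2 ≤ ‖q N‖ := by
    intro N
    have : q N = (((N+1)*(N+1+m) : ℕ) : ℂ) := by simp [hq]
    rw [this, Complex.norm_natCast]
    push_cast
    have : (0:ℝ) ≤ m := by positivity
    nlinarith [(Nat.cast_nonneg N : (0:ℝ) ≤ N)]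
  have hq0 : ∀ N, q N ≠ 0 := fun N => by
    rw [← norm_pos_iff]
    exact lt_of_lt_of_le (by positivity) (hqn N)
  have hsq : Summable (fun N : ℕ => 1 / ((N:ℝ)+1)^2) := by
    have := (summable_nat_add_iff 1).2 (Real.summable_one_div_nat_pow.2 (one_lt_two))
    simpa using this
  set a : ℕ → ℂ := fun N => -k / q N with ha
  have hasum : Summable (fun N => ‖a N‖) := by
    refine Summable.of_nonneg_of_le (fun _ => norm_nonneg _) (fun N => ?_) (hsq.mul_left ‖k‖)
    rw [ha]
    simp only [norm_div, norm_neg]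
    rw [div_eq_mul_one_div]
    have := hqn N
    gcongr
  have ha1 : ∀ N, 1 + a N ≠ 0 := by
    intro N h
    apply hno (N+1) (by omega)
    rw [ha] at h
    have := hq0 N
    field_simp at h
    have h2 : q N = k := by linear_combination h
    rw [← h2, hq]; push_cast; ring
  have hP := tprod_one_add_ne_zero_of_summable ha1 hasum
  have hT := (multipliable_one_add_of_summable hasum).hasProd.tendsto_prod_nat
  set e : ℕ → ℂ := fun N => q N * d (N+1) with he
  have hestep : ∀ N, e (N+1) = (1 + a N) * e N := by
    intro N
    have h1 := hrec (N+1)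
    have h2 := hq0 N
    simp only [he, ha]
    field_simp
    simp only [hq] at *
    push_cast at *
    linear_combination h1
  have he0 : e 0 = -k * d 0 := by
    have := hrec 0
    simp [he, hq] at *
    linear_combination this
  have heprod : ∀ N, e N = (∏ i ∈ Finset.range N, (1 + a i)) * e 0 := by
    intro N
    induction N with
    | zero => simp
    | succ N ih => rw [hestep, ih, Finset.prod_range_succ]; ring
  have heT : Tendsto e atTop (𝓝 ((∏' i, (1 + a i)) * e 0)) := by
    exact (hT.mul_const (e 0)).congr (fun N => (heprod N).symm)
  have hpart : ∀ N, ∑ i ∈ Finset.range (N+1), -k * d i = e N := by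
    intro N
    induction N with
    | zero => simp [he0]
    | succ N ih =>
      rw [Finset.sum_range_succ, ih]
      have h1 := hrec (N+1)
      simp only [he, hq]
      push_cast at *
      linear_combination -h1
  obtain ⟨B, hB⟩ := heT.norm.bddAbove_range
  have hds : Summable (fun j => ‖d j‖) := by
    rw [← summable_nat_add_iff 1]
    refine Summable.of_nonneg_of_le (fun _ => norm_nonneg _) (fun N => ?_) (hsq.mul_left B)
    have h1 : ‖e N‖ ≤ B := hB ⟨N, rfl⟩
    simp only [he, norm_mul] at h1
    rw [mul_one_div, le_div_iff₀ (by positivity)]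
    nlinarith [hqn N, norm_nonneg (d (N+1))]
  refine ⟨hds, fun hz => ?_⟩
  have hs : HasSum (fun j => -k * d j) 0 := by
    have := (hds.of_norm.hasSum).mul_left (-k)
    rwa [hz, mul_zero] at this
  have h1 := (tendsto_add_atTop_iff_nat 1).2 hs.tendsto_sum_nat
  simp only [hpart] at h1
  have := tendsto_nhds_unique heT h1
  rw [he0] at this
  simp_all

lemma hs_congr {f g : ℕ → ℂ} {a b : ℂ} (h : HasSum f a) (hfg : ∀ j, g j = f j) (hab : b = a) :
    HasSum g b := by
  rw [funext hfg, hab]; exact h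

def PS (f : ℝ → ℂ) (c : ℕ → ℂ) : Prop :=
  ∀ᶠ r : ℝ in 𝓝 0, HasSum (fun j => (r:ℂ)^j * c j) (f r)

noncomputable def ser (c : ℕ → ℂ) : FormalMultilinearSeries ℝ ℝ ℂ :=
  fun n => ContinuousMultilinearMap.mkPiRing ℝ (Fin n) (c n)

lemma ser_coeff (c : ℕ → ℂ) (n : ℕ) : (ser c).coeff n = c n := by
  simp [ser, FormalMultilinearSeries.coeff]

lemma PS_iff (f : ℝ → ℂ) (c : ℕ → ℂ) : PS f c ↔ HasFPowerSeriesAt f (ser c) 0 := by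
  rw [hasFPowerSeriesAt_iff]
  simp [PS, ser_coeff]

lemma PS_exists {f : ℝ → ℂ} (h : AnalyticAt ℝ f 0) : ∃ c, PS f c := by
  obtain ⟨p, hp⟩ := h
  refine ⟨fun n => p.coeff n, ?_⟩
  rw [hasFPowerSeriesAt_iff] at hp
  simpa [PS] using hp

lemma PS_deriv {f : ℝ → ℂ} {c : ℕ → ℂ} (h : PS f c) :
    PS (fun r => (r:ℂ) * deriv f r) (fun j => (j:ℂ) * c j) := by
  rw [PS_iff] at h
  obtain ⟨ρ, hρ⟩ := h
  have h2 := hρ.fderiv.eventually_hasSum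
  refine h2.mono fun r hr => ?_
  have h3 := hr.mapL (ContinuousLinearMap.apply ℝ ℂ r)
  simp only [ContinuousLinearMap.apply_apply, FormalMultilinearSeries.derivSeries_apply_diag, zero_add] at h3
  rw [← hasSum_nat_add_iff' 1]
  convert h3 using 1
  · funext n
    simp [ser]
    ring
  · simp

lemma PS_shift {f : ℝ → ℂ} {c : ℕ → ℂ} (h : PS f c) :
    PS (fun r => (r:ℂ)^2 * f r) (fun j => if 2 ≤ j then c (j-2) else 0) := by
  refine h.mono fun r hr => ?_
  rw [← hasSum_nat_add_iff' 2]
  refine hs_congr (hr.mul_left ((r:ℂ)^2)) (fun n => ?_) ?_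
  · simp; ring
  · simp [Finset.sum_range_succ]

lemma PS_zero {f : ℝ → ℂ} {c : ℕ → ℂ} (h : PS f c) (hf : ∀ᶠ r in 𝓝 0, f r = 0) (j : ℕ) :
    c j = 0 := by
  rw [PS_iff] at h
  have := h.eq_zero_of_eventually hf
  rw [← ser_coeff c j, this]; simp [FormalMultilinearSeries.coeff]

/-- recurrence -/
lemma PS_rec (n : ℤ) (k : ℂ) (f : ℝ → ℂ) (hf : AnalyticAt ℝ f 0)
    (hode : ∀ r ∈ Set.Ioo (0 : ℝ) 1,
      (r : ℂ) ^ 2 * (1 - (r : ℂ) ^ 2) * deriv (deriv f) r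
        + (r : ℂ) * (1 - (r : ℂ) ^ 2) * deriv f r
        + (4 * k * (r : ℂ) ^ 2 - (n : ℂ) ^ 2 * (1 - (r : ℂ) ^ 2)) * f r = 0)
    {c : ℕ → ℂ} (h : PS f c) (j : ℕ) :
    ((j:ℂ)^2 - (n:ℂ)^2) * c j =
      if 2 ≤ j then ((((j-2:ℕ):ℂ))^2 - (n:ℂ)^2 - 4 * k) * c (j-2) else 0 := by
  have h1 := PS_deriv h
  have h2 := PS_deriv h1
  set g : ℝ → ℂ := fun r => (r:ℂ) * deriv (fun r : ℝ => (r:ℂ) * deriv f r) r with hg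
  have hsh : PS (fun r => (r:ℂ)^2 * (g r - (n:ℂ)^2 * f r - 4*k*f r)) _ :=
    PS_shift (c := fun j => (j:ℂ)*((j:ℂ) * c j) - (n:ℂ)^2 * c j - 4 * k * c j) (by
      filter_upwards [h, h2] with r hr hr2
      exact hs_congr ((hr2.sub (hr.mul_left ((n:ℂ)^2))).sub (hr.mul_left (4*k))) (fun j => by ring) rfl)
  have hall : PS (fun r => g r - (n:ℂ)^2 * f r - (r:ℂ)^2 * (g r - (n:ℂ)^2 * f r - 4*k*f r))
     (fun j => (j:ℂ)*((j:ℂ) * c j) - (n:ℂ)^2 * c j - 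
       if 2 ≤ j then (((j-2:ℕ):ℂ)*(((j-2:ℕ):ℂ) * c (j-2)) - (n:ℂ)^2 * c (j-2) - 4 * k * c (j-2)) else 0) := by
    filter_upwards [h, h2, hsh] with r hr hr2 hr3
    exact hs_congr ((hr2.sub (hr.mul_left ((n:ℂ)^2))).sub hr3) (fun j => by ring) rfl
  have han : AnalyticAt ℝ (fun r => g r - (n:ℂ)^2 * f r - (r:ℂ)^2 * (g r - (n:ℂ)^2 * f r - 4*k*f r)) 0 :=
    ⟨_, (PS_iff _ _).1 hall⟩
  have hev : ∀ᶠ r : ℝ in 𝓝 0, g r - (n:ℂ)^2 * f r - (r:ℂ)^2 * (g r - (n:ℂ)^2 * f r - 4*k*f r) = 0 := by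
    refine han.frequently_zero_iff_eventually_zero.1 ?_
    have e1 : ∀ᶠ r : ℝ in 𝓝[>] 0, g r - (n:ℂ)^2 * f r - (r:ℂ)^2 * (g r - (n:ℂ)^2 * f r - 4*k*f r) = 0 := by
      filter_upwards [Ioo_mem_nhdsGT (zero_lt_one), nhdsWithin_le_nhds hf.deriv.eventually_analyticAt] with r hr hfr
      have hd : deriv (fun r : ℝ => (r:ℂ) * deriv f r) r = deriv f r + r * deriv (deriv f) r := by
        have := (Complex.ofRealCLM.hasDerivAt (x := r)).mul hfr.differentiableAt.hasDerivAt
        have := this.deriv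
        simpa [Pi.mul_def] using this
      rw [hg]; simp only [hd]
      linear_combination hode r hr
    exact e1.frequently.filter_mono (nhdsWithin_mono _ (fun x hx => ne_of_gt hx))
  have := PS_zero hall hev j
  split_ifs at this ⊢ <;> linear_combination this

/-- power series with summable coefficients: value at one -/
lemma PS_one {f : ℝ → ℂ} {c : ℕ → ℂ} (h : PS f c) (hc : Summable (fun j => ‖c j‖))
    (hf : AnalyticOnNhd ℝ f (Set.Icc 0 1)) : f 1 = ∑' j, c j := by
  have hrad : (1 : ENNReal) ≤ (ser c).radius := by
    have := (ser c).le_radius_of_bound (∑' j, ‖c j‖) (r := 1) (fun n => by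
      simp only [ser, ContinuousMultilinearMap.norm_mkPiRing, NNReal.coe_one, one_pow, mul_one]
      exact hc.le_tsum n (fun _ _ => norm_nonneg _))
    simpa using this
  have hball := (ser c).hasFPowerSeriesOnBall (lt_of_lt_of_le one_pos hrad)
  have hF : AnalyticOnNhd ℝ (ser c).sum (Set.Ico 0 1) := by
    intro x hx
    apply hball.analyticOnNhd
    refine Metric.eball_subset_eball hrad ?_
    rw [Metric.mem_eball, edist_dist, ENNReal.ofReal_lt_one, Real.dist_eq, sub_zero, abs_of_nonneg hx.1]
    exact hx.2
  have hsum : ∀ r : ℝ, (ser c).sum r = ∑' j, (r:ℂ)^j * c j := by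
    intro r
    simp [FormalMultilinearSeries.sum, ser]
  have hev : f =ᶠ[𝓝 0] (ser c).sum := by
    filter_upwards [h] with r hr
    rw [hsum, hr.tsum_eq]
  have hEq := (hf.mono Set.Ico_subset_Icc_self).eqOn_of_preconnected_of_eventuallyEq hF
    isPreconnected_Ico (Set.left_mem_Ico.2 one_pos) hev
  have t1 : Tendsto f (𝓝[<] 1) (𝓝 (f 1)) :=
    ((hf 1 (by simp)).continuousAt.tendsto).mono_left nhdsWithin_le_nhds
  have t2 : Tendsto (fun r : ℝ => ∑' j, (r:ℂ)^j * c j) (𝓝[<] 1) (𝓝 (∑' j, c j)) := by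
    refine tendsto_tsum_of_dominated_convergence (bound := fun j => ‖c j‖) hc (fun j => ?_) ?_
    · have : Continuous (fun r : ℝ => (r:ℂ)^j * c j) := by fun_prop
      have := (this.tendsto 1).mono_left (nhdsWithin_le_nhds (s := Set.Iio 1))
      simpa using this
    · filter_upwards [Ioo_mem_nhdsLT (zero_lt_one (α := ℝ))] with r hr j
      rw [norm_mul, norm_pow, Complex.norm_real, Real.norm_eq_abs, abs_of_pos hr.1]
      exact mul_le_of_le_one_left (norm_nonneg _) (pow_le_one₀ hr.1.le hr.2.le)
  refine tendsto_nhds_unique (t1.congr' ?_) t2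
  filter_upwards [Ioo_mem_nhdsLT (zero_lt_one (α := ℝ))] with r hr
  rw [hEq ⟨hr.1.le, hr.2⟩, hsum]



/-- If `f` is real-analytic on a neighbourhood of `[0,1]`, not identically zero there,
solves the separated ODE `r²(1-r²)f″ + r(1-r²)f′ + (4kr² - n²(1-r²))f = 0` on `(0,1)`
with `f(1) = 0` and `k ≠ 0`, then `k = ν(m+ν)` for some positive integer `ν`,
where `m = |n|`.  In particular `k` is a positive integer. -/
theorem eigenvalue_is_positive_integer (n : ℤ) (k : ℂ) (hk : k ≠ 0) (f : ℝ → ℂ)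
    (U : Set ℝ) (hU : IsOpen U) (hIcc : Set.Icc (0 : ℝ) 1 ⊆ U)
    (hf : ∀ r ∈ U, AnalyticAt ℝ f r)
    (hode : ∀ r ∈ Set.Ioo (0 : ℝ) 1,
      (r : ℂ) ^ 2 * (1 - (r : ℂ) ^ 2) * deriv (deriv f) r
        + (r : ℂ) * (1 - (r : ℂ) ^ 2) * deriv f r
        + (4 * k * (r : ℂ) ^ 2 - (n : ℂ) ^ 2 * (1 - (r : ℂ) ^ 2)) * f r = 0)
    (hf1 : f 1 = 0)
    (hne : ∃ r ∈ Set.Icc (0 : ℝ) 1, f r ≠ 0) :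
    ∃ ν : ℕ, 1 ≤ ν ∧ k = (ν : ℂ) * ((n.natAbs : ℂ) + (ν : ℂ)) := by
  by_contra hcon
  have hno : ∀ ν : ℕ, 1 ≤ ν → k ≠ (ν:ℂ) * ((n.natAbs:ℂ) + ν) := fun ν h1 h2 => hcon ⟨ν, h1, h2⟩
  have hfa : AnalyticOnNhd ℝ f (Set.Icc 0 1) := fun x hx => hf x (hIcc hx)
  have hf0 : AnalyticAt ℝ f 0 := hfa 0 (by simp)
  obtain ⟨c, hc⟩ := PS_exists hf0
  have hrec := PS_rec n k f hf0 hode hc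
  have hnm : (n:ℂ)^2 = (n.natAbs:ℂ)^2 := by
    rw [← Int.cast_natCast (R := ℂ) n.natAbs, ← Int.cast_pow, ← Int.cast_pow, Int.natAbs_sq]
  rw [hnm] at hrec
  generalize n.natAbs = m at *
  have hc0 : ∀ j, (∀ ν, m + 2 * ν ≠ j) → c j = 0 := by
    intro j
    induction j using Nat.strong_induction_on with
    | _ j ih =>
      intro hj
      have h1 := hrec j
      have hR : (if 2 ≤ j then ((((j-2:ℕ):ℂ))^2 - (m:ℂ)^2 - 4 * k) * c (j-2) else 0) = 0 := by
        split_ifs with h2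
        · rw [ih (j-2) (by omega) (fun ν hν => hj (ν+1) (by omega)), mul_zero]
        · rfl
      rw [hR] at h1
      refine (mul_eq_zero.1 h1).resolve_left fun h3 => hj 0 ?_
      have h4 : j ^ 2 = m ^ 2 := by exact_mod_cast sub_eq_zero.1 h3
      have := Nat.pow_left_injective (two_ne_zero) h4
      omega
  have hinj : Function.Injective (fun ν : ℕ => m + 2 * ν) := fun a b h => by
    simp only at h; omega
  have hc0' : ∀ j, j ∉ Set.range (fun ν : ℕ => m + 2 * ν) → c j = 0 := fun j hj =>
    hc0 j (fun ν h => hj ⟨ν, h⟩)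
  set d : ℕ → ℂ := fun ν => c (m + 2 * ν) with hd
  have hdrec : ∀ N : ℕ, ((N:ℂ)+1)*((N:ℂ)+1+m) * d (N+1) = ((N:ℂ)*((N:ℂ)+m) - k) * d N := by
    intro N
    have h1 := hrec (m + 2 * (N + 1))
    rw [if_pos (by omega), show m + 2 * (N+1) - 2 = m + 2 * N by omega] at h1
    simp only [hd]
    push_cast at h1
    linear_combination h1 / 4
  have hd0 : d 0 ≠ 0 := by
    intro h0
    have hdz : ∀ N, d N = 0 := by
      intro N
      induction N with
      | zero => exact h0
      | succ N ih =>
        have h1 := hdrec N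
        rw [ih, mul_zero] at h1
        refine (mul_eq_zero.1 h1).resolve_left ?_
        have : (((N+1)*(N+1+m) : ℕ) : ℂ) ≠ 0 := Nat.cast_ne_zero.2 (by positivity)
        push_cast at this
        exact this
    have hcz : ∀ j, c j = 0 := by
      intro j
      by_cases hj : j ∈ Set.range (fun ν : ℕ => m + 2 * ν)
      · obtain ⟨ν, rfl⟩ := hj
        exact hdz ν
      · exact hc0' j hj
    have hev : f =ᶠ[𝓝 0] 0 := by
      refine hc.mono fun r hr => ?_
      simp only [hcz, mul_zero] at hr
      exact hr.unique hasSum_zero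
    obtain ⟨r, hr, hr0⟩ := hne
    exact hr0 (hfa.eqOn_zero_of_preconnected_of_eventuallyEq_zero isPreconnected_Icc
      (Set.left_mem_Icc.2 zero_le_one) hev hr)
  obtain ⟨hs, hne0⟩ := seq_lemma m k hk d hd0 hdrec hno
  have hcs : Summable (fun j => ‖c j‖) := by
    rw [← hinj.summable_iff (fun j hj => by rw [hc0' j hj, norm_zero])]
    exact hs
  apply hne0
  have h1 := PS_one hc hcs hfa
  rw [hf1] at h1
  rw [h1]
  refine hinj.tsum_eq (f := c) (fun j hj => ?_)
  by_contra h
  exact hj (hc0' j h)
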